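/- Let (S,m) be a complete regular local ring of dimension 2 with algebraically closed residue field of characteristic not 2, and R = S/(f) a reduced hypersurface with f = f_1⋯f_n a factorization into primes. Then any indecomposable rigid object of MCM(R) (i.e., indecomposable MCM module M with Ext_R^1(M,M) = 0) is isomorphic, up to free summands, to S_I = S/(∏_{i∈I} f_i) for some subset I ⊆ {1,…,n}. -/

import Mathlib

open CategoryTheory Opposite IsLocalRing

noncomputable abbrev ExtGroup (R : Type) [CommRing R] (i : ℕ)
    (M N : Type) [AddCommGroup M] [Module R M] [AddCommGroup N] [Module R N] : Type :=
  ((Ext R (ModuleCat R) i).obj (op (ModuleCat.of R M))).obj (ModuleCat.of R N)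

noncomputable def moduleDepth (R : Type) [CommRing R] [IsLocalRing R]
    (M : Type) [AddCommGroup M] [Module R M] : ℕ∞ :=
  sInf {i : ℕ∞ | ∃ n : ℕ, i = n ∧ Nontrivial (ExtGroup R n (ResidueField R) M)}

def IsRegularLocalTwoDim (S : Type) [CommRing S] [IsLocalRing S] : Prop :=
  IsNoetherianRing S ∧ ringKrullDim S = 2 ∧
    ∃ x y : S, IsLocalRing.maximalIdeal S = Ideal.span {x, y}

def IsMCM1 (R : Type) [CommRing R] [IsLocalRing R]
    (M : Type) [AddCommGroup M] [Module R M] : Prop :=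
  Module.Finite R M ∧ moduleDepth R M = 1

/-- An indecomposable module: nontrivial, and every idempotent endomorphism is `0` or the
identity. -/
def IsIndecomposable (R : Type) [CommRing R]
    (M : Type) [AddCommGroup M] [Module R M] : Prop :=
  Nontrivial M ∧ ∀ e : M →ₗ[R] M, e ∘ₗ e = e → e = 0 ∨ e = LinearMap.id

namespace RigidSI

theorem span_shift {S : Type} [CommRing S] (x y : S) (k : ℕ) :
    Ideal.span {x + y ^ (k + 1), y} = Ideal.span {x, y} := by
  apply le_antisymm
  · rw [Ideal.span_le]
    rintro z (rfl | rfl)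
    · exact Ideal.mem_span_pair.2 ⟨1, y ^ k, by ring⟩
    · exact Ideal.subset_span (by simp)
  · rw [Ideal.span_le]
    rintro z (rfl | rfl)
    · exact Ideal.mem_span_pair.2 ⟨1, - y ^ k, by ring⟩
    · exact Ideal.subset_span (by simp)

theorem exists_avoid {S : Type} [CommRing S] [IsLocalRing S] (x y : S)
    (hm : maximalIdeal S = Ideal.span {x, y}) (Ps : Set (Ideal S)) (hfin : Ps.Finite)
    (hprime : ∀ P ∈ Ps, P.IsPrime) (hne : ∀ P ∈ Ps, P ≠ maximalIdeal S) :
    ∃ k : ℕ, ∀ P ∈ Ps, x + y ^ (k + 1) ∉ P := by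
  by_contra! h
  choose g hg hg' using h
  have : ¬ Function.Injective (fun k => (⟨g k, hg k⟩ : Ps)) := by
    have := hfin.to_subtype
    exact not_injective_infinite_finite _
  simp only [Function.Injective, not_forall] at this
  obtain ⟨a, b, hab, hne'⟩ := this
  have hab' : g a = g b := by simpa using hab
  clear hab
  have hab := hab'
  clear hab'
  wlog hlt : a < b generalizing a b
  · exact this b a (Ne.symm hne') hab.symm (by omega)
  have hP := hprime _ (hg a)
  have h1 := hg' a
  have h2 := hg' b
  rw [← hab] at h2
  have h3 := (g a).sub_mem h1 h2
  obtain ⟨c, rfl⟩ := Nat.exists_eq_add_of_lt hlt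
  have hym : y ∈ maximalIdeal S := by rw [hm]; exact Ideal.subset_span (by simp)
  have h4 : y ^ (a + 1) * (1 - y ^ (c + 1)) ∈ g a := by
    convert h3 using 1; ring
  have hu : IsUnit (1 - y ^ (c + 1)) := by
    apply IsLocalRing.isUnit_one_sub_self_of_mem_nonunits
    exact (maximalIdeal S).pow_mem_of_mem hym (c + 1) (by omega)
  have h5 : y ^ (a + 1) ∈ g a := by
    rcases hP.mem_or_mem h4 with h | h
    · exact h
    · exact absurd (Ideal.eq_top_of_isUnit_mem _ h hu) hP.ne_top
  have h6 : y ∈ g a := hP.mem_of_pow_mem _ h5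
  have h7 : x ∈ g a := by
    have := (g a).sub_mem h1 h5
    simpa using this
  apply hne _ (hg a)
  apply le_antisymm (le_maximalIdeal hP.ne_top)
  rw [hm, Ideal.span_le]
  rintro z (rfl | rfl) <;> assumption

/-- a Noetherian local ring with principal maximal ideal and positive dimension is a domain. -/
theorem isDomain_of_principal {D : Type} [CommRing D] [IsLocalRing D] [IsNoetherianRing D] (y : D)
    (hm : maximalIdeal D = Ideal.span {y}) (hy : ¬ IsNilpotent y) : IsDomain D := by
  have key : ∀ a : D, a ≠ 0 → ∃ n : ℕ, ∃ u : Dˣ, a = y ^ n * u := by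
    intro a ha
    have hK := Ideal.iInf_pow_eq_bot_of_isLocalRing (maximalIdeal D) (Ideal.IsPrime.ne_top inferInstance)
    have : ∃ n, a ∉ maximalIdeal D ^ n := by
      by_contra! h
      apply ha
      rw [← Ideal.mem_bot, ← hK]
      simpa using h
    classical
    have hn := Nat.find_spec this
    have hn' := fun k => Nat.find_min this (m := k)
    set n := Nat.find this
    have hpos : n ≠ 0 := by
      intro h0; rw [h0] at hn; simp at hn
    obtain ⟨k, hk⟩ := Nat.exists_eq_succ_of_ne_zero hpos
    have h1 := hn' k (by omega)
    rw [not_not, hm, Ideal.span_singleton_pow, Ideal.mem_span_singleton] at h1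
    obtain ⟨c, rfl⟩ := h1
    have hc : IsUnit c := by
      by_contra hc
      apply hn
      have : c ∈ maximalIdeal D := hc
      rw [hm, Ideal.mem_span_singleton] at this
      obtain ⟨d, rfl⟩ := this
      rw [hm, Ideal.span_singleton_pow, Ideal.mem_span_singleton, hk]
      exact ⟨d, by rw [Nat.succ_eq_add_one]; ring⟩
    exact ⟨k, hc.unit, by simp⟩
  have : NoZeroDivisors D := by
    refine ⟨fun {a b} hab => ?_⟩
    by_contra! h
    obtain ⟨i, u, rfl⟩ := key a h.1
    obtain ⟨j, v, rfl⟩ := key b h.2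
    apply hy
    refine ⟨i + j, ?_⟩
    have : y ^ (i + j) * ((u * v : Dˣ) : D) = 0 := by rw [← hab]; push_cast; ring
    exact (Units.mul_left_eq_zero _).1 this
  exact NoZeroDivisors.to_isDomain D

theorem quotient_facts {S : Type} [CommRing S] [IsLocalRing S] [IsNoetherianRing S]
    (hdim : ringKrullDim S = 2) (x y : S) (hm : maximalIdeal S = Ideal.span {x, y}) :
    IsDomain (S ⧸ Ideal.span {x}) ∧ IsPrincipalIdealRing (S ⧸ Ideal.span {x}) := by
  have hxm : x ∈ maximalIdeal S := by rw [hm]; exact Ideal.subset_span (by simp)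
  have hle : Ideal.span {x} ≤ maximalIdeal S := by simpa [Ideal.span_le] using hxm
  have : Nontrivial (S ⧸ Ideal.span {x}) :=
    Ideal.Quotient.nontrivial_iff.2 (fun h => by
      rw [h] at hle; exact (maximalIdeal.isMaximal S).ne_top (top_le_iff.1 hle))
  have hloc : IsLocalRing (S ⧸ Ideal.span {x}) :=
    IsLocalRing.of_surjective' _ Ideal.Quotient.mk_surjective
  have hmD : maximalIdeal (S ⧸ Ideal.span {x}) =
      Ideal.span {Ideal.Quotient.mk (Ideal.span {x}) y} := by
    have h1 : (maximalIdeal S).map (Ideal.Quotient.mk (Ideal.span {x})) =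
        maximalIdeal (S ⧸ Ideal.span {x}) := by
      apply IsLocalRing.map_maximalIdeal_of_surjective
      exact Ideal.Quotient.mk_surjective
    rw [← h1, hm, Ideal.map_span, Set.image_pair]
    have : Ideal.Quotient.mk (Ideal.span {x}) x = 0 :=
      Ideal.Quotient.eq_zero_iff_mem.2 (Ideal.mem_span_singleton_self x)
    rw [this, Ideal.span_insert_zero]
  have hnil : ¬ IsNilpotent (Ideal.Quotient.mk (Ideal.span {x}) y) := by
    intro hn
    have h0 : Ring.KrullDimLE 0 (S ⧸ Ideal.span {x}) := by
      rw [Ring.krullDimLE_zero_iff]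
      intro I hI
      have : maximalIdeal (S ⧸ Ideal.span {x}) ≤ I := by
        rw [hmD, Ideal.span_le]
        rintro z rfl
        obtain ⟨k, hk⟩ := hn
        exact hI.mem_of_pow_mem k (by rw [hk]; exact I.zero_mem)
      rw [← (maximalIdeal.isMaximal _).eq_of_le hI.ne_top this]
      exact maximalIdeal.isMaximal _
    have h1 := ringKrullDim_le_ringKrullDim_quotient_add_card ({x} : Finset S) (by
      rw [IsLocalRing.ringJacobson_eq_maximalIdeal]; simpa using hxm)
    rw [Ring.krullDimLE_iff] at h0
    rw [hdim] at h1
    rw [Finset.coe_singleton] at h1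
    simp only [Finset.card_singleton] at h1
    have h2 : (2 : WithBot ℕ∞) ≤ 0 + 1 := h1.trans (add_le_add (by simpa using h0) (by simp))
    norm_num at h2
  have hdom := isDomain_of_principal _ hmD hnil
  refine ⟨hdom, ?_⟩
  have hpr : (maximalIdeal (S ⧸ Ideal.span {x})).IsPrincipal := ⟨⟨_, hmD⟩⟩
  have := (tfae_of_isNoetherianRing_of_isLocalRing_of_isDomain (S ⧸ Ideal.span {x})).out 0 4
  exact this.2 hpr

theorem isDomain_of_regular {S : Type} [CommRing S] [IsLocalRing S] [IsNoetherianRing S]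
    (hdim : ringKrullDim S = 2) (x y : S) (hm : maximalIdeal S = Ideal.span {x, y}) :
    IsDomain S := by
  obtain ⟨k, hk⟩ := exists_avoid x y hm (minimalPrimes S) (minimalPrimes.finite_of_isNoetherianRing S)
    (fun P hP => hP.1.1) (by
      intro P hP h
      have h0 : Ring.KrullDimLE 0 S := by
        rw [Ring.krullDimLE_zero_iff]
        intro I hI
        have : maximalIdeal S ≤ I := by
          rw [← h]
          exact hP.2 ⟨hI, bot_le⟩ (by rw [h]; exact le_maximalIdeal hI.ne_top)
        rw [← (maximalIdeal.isMaximal _).eq_of_le hI.ne_top this]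
        exact maximalIdeal.isMaximal _
      rw [Ring.krullDimLE_iff, hdim] at h0
      norm_num at h0)
  set t := x + y ^ (k + 1)
  have hm' : maximalIdeal S = Ideal.span {t, y} := by rw [span_shift, hm]
  have htm : t ∈ maximalIdeal S := by rw [hm']; exact Ideal.subset_span (by simp)
  have hp : (Ideal.span {t}).IsPrime := by
    rw [← Ideal.Quotient.isDomain_iff_prime]
    exact (quotient_facts hdim t y hm').1
  obtain ⟨P, hP, hPt⟩ := Ideal.exists_minimalPrimes_le (I := (⊥ : Ideal S)) (J := Ideal.span {t}) bot_le
  have hPprime : P.IsPrime := hP.1.1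
  have htP := hk P hP
  have hle : P ≤ maximalIdeal S • P := by
    intro p hpP
    obtain ⟨c, rfl⟩ := Ideal.mem_span_singleton.1 (hPt hpP)
    have hc : c ∈ P := (hPprime.mem_or_mem hpP).resolve_left htP
    exact Submodule.smul_mem_smul htm hc
  have hbot : P = ⊥ := by
    apply Submodule.eq_bot_of_le_smul_of_le_jacobson_bot (maximalIdeal S) P (IsNoetherian.noetherian P) hle
    rw [IsLocalRing.jacobson_eq_maximalIdeal _ bot_ne_top]
  rw [hbot] at hPprime
  exact IsDomain.of_bot_isPrime S
end RigidSI

namespace RigidSI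

/-- a finite module over a PID all of whose idempotent endomorphisms are trivial is cyclic. -/
theorem cyclic_of_pid {D V : Type} [CommRing D] [IsDomain D] [IsPrincipalIdealRing D]
    [AddCommGroup V] [Module D V] [Module.Finite D V]
    (hV : ∀ e : V →ₗ[D] V, e ∘ₗ e = e → e = 0 ∨ e = LinearMap.id) :
    ∃ v : V, ∀ w : V, ∃ d : D, w = d • v := by
  classical
  obtain ⟨n, ι, _, p, -, e, ⟨E⟩⟩ := Module.equiv_free_prod_directSum (R := D) (M := V)
  have key : ∀ (Z : Type) [AddCommGroup Z] [Module D Z] (a : Z →ₗ[D] V) (b : V →ₗ[D] Z),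
      b ∘ₗ a = LinearMap.id → (∃ z : Z, ∀ w : Z, ∃ d : D, w = d • z) → a ∘ₗ b ≠ 0 →
      ∃ v : V, ∀ w : V, ∃ d : D, w = d • v := by
    intro Z _ _ a b hba ⟨z, hz⟩ hne
    have h1 := hV (a ∘ₗ b) (by
      ext v
      have := LinearMap.congr_fun hba (b v)
      simp at this
      simp [this])
    have h2 := h1.resolve_left hne
    refine ⟨a z, fun w => ?_⟩
    obtain ⟨d, hd⟩ := hz (b w)
    refine ⟨d, ?_⟩
    rw [← map_smul, ← hd]
    exact (LinearMap.congr_fun h2 w).symm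
  by_contra hcon
  have hz1 : ∀ i : Fin n, ∀ v : V, (E v).1 i = 0 := by
    intro i
    by_contra! hv
    apply hcon
    refine key D (E.symm.toLinearMap ∘ₗ LinearMap.inl D _ _ ∘ₗ Finsupp.lsingle i)
      (Finsupp.lapply i ∘ₗ LinearMap.fst D _ _ ∘ₗ E.toLinearMap) ?_ ⟨1, fun w => ⟨w, by simp⟩⟩ ?_
    · ext; simp
    · intro h0
      obtain ⟨v, hv⟩ := hv
      have := LinearMap.congr_fun h0 v
      simp at this
      exact hv this
  have hz2 : ∀ i : ι, ∀ v : V, (E v).2 i = 0 := by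
    intro i
    by_contra! hv
    apply hcon
    refine key (D ⧸ Submodule.span D {p i ^ e i})
      (E.symm.toLinearMap ∘ₗ LinearMap.inr D _ _ ∘ₗ DirectSum.lof D ι (fun i => D ⧸ Submodule.span D {p i ^ e i}) i)
      (DirectSum.component D ι (fun i => D ⧸ Submodule.span D {p i ^ e i}) i ∘ₗ LinearMap.snd D _ _ ∘ₗ E.toLinearMap) ?_
      ⟨Submodule.Quotient.mk 1, fun w => ?_⟩ ?_
    · ext; simp
    · obtain ⟨w, rfl⟩ := Submodule.Quotient.mk_surjective _ w
      exact ⟨w, by rw [← Submodule.Quotient.mk_smul]; simp⟩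
    · intro h0
      obtain ⟨v, hv⟩ := hv
      apply hv
      have h1 := LinearMap.congr_fun h0 v
      simp only [LinearMap.comp_apply, LinearEquiv.coe_coe, LinearMap.zero_apply,
        LinearEquiv.map_eq_zero_iff] at h1
      have h2 := congrArg (fun z => z.2 i) h1
      simp [DirectSum.lof_eq_of, DirectSum.component] at h2
      exact h2
  apply hcon
  refine ⟨0, fun w => ⟨0, ?_⟩⟩
  have : E w = 0 := by
    ext i
    · simpa using hz1 i w
    · exact hz2 i w
  simpa using this

theorem isPrecomplete_of_finite {S E : Type} [CommRing S] (I : Ideal S)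
    [hc : IsAdicComplete I S] [AddCommGroup E] [Module S E] [Module.Finite S E] :
    IsPrecomplete I E := by
  rw [← AdicCompletion.of_surjective_iff]
  intro z
  obtain ⟨w, rfl⟩ := AdicCompletion.ofTensorProduct_surjective_of_finite I E z
  induction w with
  | zero => exact ⟨0, by simp⟩
  | tmul r x =>
    obtain ⟨r, rfl⟩ := AdicCompletion.of_surjective (I := I) (M := S) r
    refine ⟨r • x, ?_⟩
    rw [AdicCompletion.ofTensorProduct_tmul, map_smul]
    ext n
    simp
    rfl
  | add a b ha hb =>
    obtain ⟨a', ha⟩ := ha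
    obtain ⟨b', hb⟩ := hb
    exact ⟨a' + b', by rw [map_add, map_add, ha, hb]⟩

theorem mul_mem_left {S M : Type} [CommRing S] [AddCommGroup M] [Module S M] (I : Ideal S)
    (a b : Module.End S M) (hb : b ∈ (I • ⊤ : Submodule S (Module.End S M))) :
    a * b ∈ (I • ⊤ : Submodule S (Module.End S M)) := by
  have := Submodule.mem_map_of_mem (f := LinearMap.mulLeft S a) hb
  rw [Submodule.map_smul''] at this
  exact Submodule.smul_mono le_rfl le_top this

theorem mul_mem_right {S M : Type} [CommRing S] [AddCommGroup M] [Module S M] (I : Ideal S)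
    (a b : Module.End S M) (hb : b ∈ (I • ⊤ : Submodule S (Module.End S M))) :
    b * a ∈ (I • ⊤ : Submodule S (Module.End S M)) := by
  have := Submodule.mem_map_of_mem (f := LinearMap.mulRight S a) hb
  rw [Submodule.map_smul''] at this
  exact Submodule.smul_mono le_rfl le_top this

theorem lift_idempotent {S M : Type} [CommRing S] [IsLocalRing S] [IsNoetherianRing S]
    [IsAdicComplete (maximalIdeal S) S] [AddCommGroup M] [Module S M] [Module.Finite S M]
    (t : S) (ht : t ∈ maximalIdeal S) (φ c : Module.End S M) (hφ : φ * φ - φ = t • c) :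
    ∃ L : Module.End S M, L * L = L ∧
      ∀ n : ℕ, ∃ a b : Module.End S M, L - φ = t • a + b ∧
        b ∈ (maximalIdeal S ^ n • ⊤ : Submodule S (Module.End S M)) := by
  set m := maximalIdeal S
  have hfin : Module.Finite S (Module.End S M) :=
    Module.IsNoetherian.finite S (M →ₗ[S] M)
  let T : ℕ → Module.End S M := fun n => (fun φ => φ + (φ * φ - φ) * (1 - 2 * φ))^[n] φ
  have hT0 : T 0 = φ := rfl
  have hTs : ∀ n, T (n + 1) = T n + (T n * T n - T n) * (1 - 2 * T n) := by
    intro n; simp only [T, Function.iterate_succ_apply']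
  have h1 : ∀ n, ∃ c, T n * T n - T n = t ^ (n + 1) • c := by
    intro n
    induction n with
    | zero => exact ⟨c, by rw [hT0]; simpa using hφ⟩
    | succ n ih =>
      obtain ⟨c, hc⟩ := ih
      have e1 : T (n + 1) * T (n + 1) - T (n + 1) =
          (T n * T n - T n) * (T n * T n - T n) * (4 * (T n * T n - T n) - 3) := by
        rw [hTs]; noncomm_ring
      refine ⟨t ^ n • (c * c * (4 * (T n * T n - T n) - 3)), ?_⟩
      rw [e1]
      nth_rewrite 1 2 [hc]
      simp only [smul_mul_assoc, mul_smul_comm, smul_smul]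
      congr 1
      ring
  choose cs hcs using h1
  have hpow : ∀ n (a : Module.End S M), t ^ n • a ∈ (m ^ n • ⊤ : Submodule S (Module.End S M)) :=
    fun n a => Submodule.smul_mem_smul (Ideal.pow_mem_pow ht n) trivial
  have hstep : ∀ n, T (n + 1) - T n = t ^ (n + 1) • (cs n * (1 - 2 * T n)) := by
    intro n
    rw [hTs, hcs]; simp
  have hcau : ∀ k n, T (n + k) - T n ∈ (m ^ n • ⊤ : Submodule S (Module.End S M)) := by
    intro k n
    induction k with
    | zero => simp
    | succ k ih =>
      have : T (n + (k + 1)) - T n = (T (n + k + 1) - T (n + k)) + (T (n + k) - T n) := by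
        rw [← add_assoc]; abel
      rw [this]
      refine add_mem ?_ ih
      rw [hstep]
      exact Submodule.smul_mono_left (Ideal.pow_le_pow_right (by omega)) (hpow _ _)
  have hprec : IsPrecomplete m (Module.End S M) := isPrecomplete_of_finite m
  obtain ⟨L, hL⟩ := hprec.prec' T (by
    intro a b hab
    obtain ⟨k, rfl⟩ := Nat.exists_eq_add_of_le hab
    rw [SModEq.comm, SModEq.sub_mem]
    exact hcau k a)
  have hL' : ∀ n, L - T n ∈ (m ^ n • ⊤ : Submodule S (Module.End S M)) := by
    intro n
    rw [← SModEq.sub_mem, SModEq.comm]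
    exact hL n
  refine ⟨L, ?_, ?_⟩
  · have hH : IsHausdorff m (Module.End S M) := inferInstance
    rw [← sub_eq_zero]
    apply hH.haus'
    intro n
    rw [SModEq.zero]
    have e2 : L * L - L = (T n * T n - T n) + T n * (L - T n) + (L - T n) * L - (L - T n) := by
      noncomm_ring
    rw [e2]
    refine sub_mem (add_mem (add_mem ?_ (mul_mem_left _ _ _ (hL' n))) (mul_mem_right _ _ _ (hL' n)))
      (hL' n)
    rw [hcs]
    exact Submodule.smul_mono_left (Ideal.pow_le_pow_right (by omega)) (hpow _ _)
  · intro n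
    have h3 : ∀ n, ∃ a, T n - φ = t • a := by
      intro n
      induction n with
      | zero => exact ⟨0, by simp [hT0]⟩
      | succ n ih =>
        obtain ⟨a, ha⟩ := ih
        refine ⟨t ^ n • (cs n * (1 - 2 * T n)) + a, ?_⟩
        have : T (n + 1) - φ = (T (n + 1) - T n) + (T n - φ) := by abel
        rw [this, ha, hstep, smul_add, smul_smul, pow_succ']
    obtain ⟨a, ha⟩ := h3 n
    exact ⟨a, L - T n, by rw [← ha]; abel, hL' n⟩

end RigidSI

namespace RigidSI

/-- Division of a linear map by a regular scalar. -/
theorem exists_div {R P M : Type} [CommRing R] [AddCommGroup P] [Module R P]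
    [AddCommGroup M] [Module R M] (t : R) (ht : ∀ z : M, t • z = 0 → z = 0)
    (ψ : P →ₗ[R] M) (h : ∀ p, ∃ w, ψ p = t • w) : ∃ c : P →ₗ[R] M, ψ = t • c := by
  have hinj : ∀ a b : M, t • a = t • b → a = b := fun a b hab =>
    sub_eq_zero.1 (ht _ (by rw [smul_sub, hab, sub_self]))
  choose c hc using h
  refine ⟨{ toFun := c, map_add' := fun a b => ?_, map_smul' := fun r a => ?_ }, ?_⟩
  · apply hinj
    rw [← hc, smul_add, ← hc, ← hc, map_add]
  · apply hinj
    rw [← hc, map_smul, hc, RingHom.id_apply, smul_comm]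
  · ext p
    exact hc p

theorem mem_span_smul {R M : Type} [CommRing R] [AddCommGroup M] [Module R M] (t : R)
    (N : Submodule R M) (z : M) :
    z ∈ (Ideal.span {t} • N : Submodule R M) ↔ ∃ w ∈ N, z = t • w := by
  rw [Submodule.ideal_span_singleton_smul, Submodule.mem_smul_pointwise_iff_exists]
  constructor
  · rintro ⟨w, hw, rfl⟩; exact ⟨w, hw, rfl⟩
  · rintro ⟨w, hw, rfl⟩; exact ⟨w, hw, rfl⟩

theorem mk_eq_iff {R M : Type} [CommRing R] [AddCommGroup M] [Module R M] (t : R) (a b : M) :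
    (Submodule.Quotient.mk a : M ⧸ (Ideal.span {t} • ⊤ : Submodule R M)) =
      Submodule.Quotient.mk b ↔ ∃ w, a - b = t • w := by
  rw [Submodule.Quotient.eq, mem_span_smul]
  simp

set_option maxHeartbeats 1000000 in
theorem core {S M : Type} [CommRing S] [IsLocalRing S] [IsNoetherianRing S]
    [IsAdicComplete (maximalIdeal S) S] (hdim : ringKrullDim S = 2) (x y : S)
    (hm : maximalIdeal S = Ideal.span {x, y})
    [AddCommGroup M] [Module S M] [Module.Finite S M]
    (hdepth : ∀ z : M, (∀ s ∈ maximalIdeal S, s • z = 0) → z = 0)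
    (hind : ∀ e : M →ₗ[S] M, e ∘ₗ e = e → e = 0 ∨ e = LinearMap.id)
    (hlift : ∀ t : S, (∀ z : M, t • z = 0 → z = 0) → ∀ γ : M → M,
      (∀ a b, ∃ w, γ (a + b) - (γ a + γ b) = t • w) →
      (∀ (s : S) a, ∃ w, γ (s • a) - s • γ a = t • w) →
      ∃ h : M →ₗ[S] M, ∀ z, ∃ w, h z - γ z = t • w) :
    ∃ g : S, Nonempty (M ≃ₗ[S] S ⧸ Ideal.span {g}) := by
  -- choose a regular parameter which is `M`-regular
  obtain ⟨k, hk⟩ := exists_avoid x y hm (associatedPrimes S M) (associatedPrimes.finite S M)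
    (fun P hP => hP.isPrime) (by
      intro P hP h
      rw [AssociatedPrimes.mem_iff, isAssociatedPrime_iff] at hP
      obtain ⟨hprime, z, hz⟩ := hP
      have hz0 : z = 0 := by
        apply hdepth
        intro s hs
        rw [← h, hz, Submodule.mem_colon_singleton] at hs
        simpa using hs
      rw [hz0] at hz
      apply hprime.ne_top
      rw [hz, Ideal.eq_top_iff_one, Submodule.mem_colon_singleton]
      simp)
  set t := x + y ^ (k + 1) with htdef
  have hm' : maximalIdeal S = Ideal.span {t, y} := by rw [span_shift, hm]
  have htm : t ∈ maximalIdeal S := by rw [hm']; exact Ideal.subset_span (by simp)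
  have hreg : ∀ z : M, t • z = 0 → z = 0 := by
    intro z hz
    by_contra hz0
    have h1 : t ∈ ⋃ p ∈ associatedPrimes S M, (p : Set S) := by
      rw [biUnion_associatedPrimes_eq_zero_divisors]
      exact ⟨z, hz0, hz⟩
    simp only [Set.mem_iUnion] at h1
    obtain ⟨P, hP, htP⟩ := h1
    exact hk P hP htP
  obtain ⟨hD1, hD2⟩ := quotient_facts hdim t y hm'
  have hjac : Ideal.span {t} ≤ (⊥ : Ideal S).jacobson := by
    rw [IsLocalRing.jacobson_eq_maximalIdeal _ bot_ne_top, Ideal.span_le]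
    simpa using htm
  let V := M ⧸ (Ideal.span {t} • ⊤ : Submodule S M)
  have hfinV : Module.Finite (S ⧸ Ideal.span {t}) V :=
    Module.Finite.of_restrictScalars_finite S _ _
  -- `M / t M` has no nontrivial idempotent endomorphisms
  have hVind : ∀ e : V →ₗ[S ⧸ Ideal.span {t}] V, e ∘ₗ e = e → e = 0 ∨ e = LinearMap.id := by
    intro e he
    have hsurj := Submodule.Quotient.mk_surjective (Ideal.span {t} • ⊤ : Submodule S M)
    let mk : M →ₗ[S] V := Submodule.mkQ _
    let e' : V →ₗ[S] V := e.restrictScalars S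
    have he' : ∀ v, e' (e' v) = e' v := fun v => LinearMap.congr_fun he v
    have hex : ∀ z : M, ∃ w : M, mk w = e' (mk z) := fun z => hsurj _
    choose γ hγ using hex
    obtain ⟨φ, hφ⟩ := hlift t hreg γ (by
      intro a b
      rw [← mk_eq_iff]
      change mk _ = mk _
      rw [map_add, hγ, hγ, hγ, map_add, map_add]) (by
      intro s a
      rw [← mk_eq_iff]
      change mk _ = mk _
      rw [map_smul, hγ, hγ, map_smul, map_smul])
    have hφ' : ∀ z, mk (φ z) = e' (mk z) := by
      intro z
      rw [← hγ]
      exact (mk_eq_iff t _ _).2 (hφ z)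
    obtain ⟨c, hc⟩ := exists_div t hreg (φ * φ - φ) (by
      intro p
      have h1 : mk (φ (φ p)) = mk (φ p) := by rw [hφ', hφ', he']
      exact (mk_eq_iff t _ _).1 h1)
    obtain ⟨L, hL, hLφ⟩ := lift_idempotent t htm φ c hc
    have hLe : ∀ z, mk (L z) = e' (mk z) := by
      intro z
      have hH : IsHausdorff (maximalIdeal S) V := inferInstance
      rw [← sub_eq_zero]
      apply hH.haus'
      intro n
      rw [SModEq.zero, ← hφ', ← map_sub]
      obtain ⟨a, b, hab, hb⟩ := hLφ n
      have h1 : L z - φ z = t • a z + b z := LinearMap.congr_fun hab z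
      have h2 : mk (t • a z) = 0 := by
        have : mk (t • a z) = mk 0 := (mk_eq_iff t _ _).2 ⟨a z, by simp⟩
        simpa using this
      rw [h1, map_add, h2, zero_add]
      have h3 := Submodule.mem_map_of_mem (f := mk ∘ₗ LinearMap.applyₗ z) hb
      rw [Submodule.map_smul''] at h3
      exact Submodule.smul_mono le_rfl le_top h3
    rcases hind L hL with h0 | h1
    · left
      refine LinearMap.ext fun v => ?_
      obtain ⟨z, rfl⟩ := hsurj v
      have := hLe z
      rw [h0, LinearMap.zero_apply, map_zero] at this
      exact this.symm
    · right
      refine LinearMap.ext fun v => ?_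
      obtain ⟨z, rfl⟩ := hsurj v
      have := hLe z
      rw [h1] at this
      exact this.symm
  obtain ⟨v, hv⟩ := cyclic_of_pid hVind
  obtain ⟨z, rfl⟩ := Submodule.Quotient.mk_surjective _ v
  -- Nakayama
  have hcyc : (⊤ : Submodule S M) ≤ Submodule.span S {z} := by
    apply Submodule.le_of_le_smul_of_le_jacobson_bot Module.Finite.fg_top hjac
    intro w _
    obtain ⟨d, hd⟩ := hv (Submodule.Quotient.mk w)
    obtain ⟨s, rfl⟩ := Ideal.Quotient.mk_surjective d
    have hd' : (Submodule.Quotient.mk w : V) = Submodule.Quotient.mk (s • z) := hd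
    rw [Submodule.Quotient.eq] at hd'
    rw [← sub_add_cancel w (s • z), add_comm]
    exact Submodule.add_mem_sup (Submodule.smul_mem _ _ (Submodule.mem_span_singleton_self z)) hd'
  have hsur : Function.Surjective (LinearMap.toSpanSingleton S M z) := by
    intro w
    obtain ⟨s, hs⟩ := Submodule.mem_span_singleton.1 (hcyc (Submodule.mem_top (x := w)))
    exact ⟨s, by simpa using hs⟩
  set J : Ideal S := LinearMap.ker (LinearMap.toSpanSingleton S M z) with hJ
  have hJmem : ∀ s, s ∈ J ↔ s • z = 0 := fun s => by rw [hJ, LinearMap.mem_ker]; simp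
  obtain ⟨d, hd⟩ := (hD2.principal (J.map (Ideal.Quotient.mk (Ideal.span {t})))).principal
  have hdmem : d ∈ J.map (Ideal.Quotient.mk (Ideal.span {t})) := by
    rw [hd]; exact Submodule.mem_span_singleton_self d
  obtain ⟨g, hgJ, rfl⟩ := (Ideal.mem_map_iff_of_surjective _ Ideal.Quotient.mk_surjective).1 hdmem
  have hJg : J = Ideal.span {g} := by
    apply le_antisymm
    · apply Submodule.le_of_le_smul_of_le_jacobson_bot (IsNoetherian.noetherian J) hjac
      intro j hj
      have h1 := Ideal.mem_map_of_mem (Ideal.Quotient.mk (Ideal.span {t})) hj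
      rw [hd] at h1
      obtain ⟨s', hs'⟩ := Submodule.mem_span_singleton.1 h1
      obtain ⟨s, rfl⟩ := Ideal.Quotient.mk_surjective s'
      rw [smul_eq_mul, ← map_mul, eq_comm, Ideal.Quotient.eq, Ideal.mem_span_singleton] at hs'
      obtain ⟨w, hw⟩ := hs'
      have hwJ : w ∈ J := by
        rw [hJmem]
        apply hreg
        rw [smul_smul, ← hw, ← hJmem]
        exact J.sub_mem hj (J.mul_mem_left _ hgJ)
      rw [← sub_add_cancel j (s * g), add_comm, hw]
      exact Submodule.add_mem_sup (Ideal.mul_mem_left _ _ (Ideal.mem_span_singleton_self g))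
        (Submodule.smul_mem_smul (Ideal.mem_span_singleton_self t) hwJ)
    · rw [Ideal.span_le]; simpa using hgJ
  refine ⟨g, ⟨(LinearMap.quotKerEquivOfSurjective _ hsur).symm.trans
    (Submodule.quotEquivOfEq _ _ hJg)⟩⟩

end RigidSI

namespace RigidSI

/-- The augmentation of a projective resolution, as a map to the resolved object. -/
noncomputable def aug {R : Type} [CommRing R] {X : ModuleCat.{0} R} (P : ProjectiveResolution X) :
    P.complex.X 0 ⟶ X :=
  P.π.f 0 ≫ (HomologicalComplex.singleObjXSelf (ComplexShape.down ℕ) 0 X).hom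

instance {R : Type} [CommRing R] {X : ModuleCat.{0} R} (P : ProjectiveResolution X) :
    Epi (aug P) := by
  unfold aug
  infer_instance

theorem d_aug {R : Type} [CommRing R] {X : ModuleCat.{0} R} (P : ProjectiveResolution X) :
    P.complex.d 1 0 ≫ aug P = 0 := by
  unfold aug
  rw [← Category.assoc, P.complex_d_comp_π_f_zero, Limits.zero_comp]

theorem aug_desc {R : Type} [CommRing R] {X Y : ModuleCat.{0} R} (P : ProjectiveResolution X)
    (k : P.complex.X 0 ⟶ Y) (hk : P.complex.d 1 0 ≫ k = 0) : ∃ h : X ⟶ Y, aug P ≫ h = k := by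
  have hex := P.exact₀
  have : Epi (ShortComplex.mk _ _ P.complex_d_comp_π_f_zero).g := by
    exact inferInstanceAs (Epi (P.π.f 0))
  refine ⟨(HomologicalComplex.singleObjXSelf (ComplexShape.down ℕ) 0 X).inv ≫ hex.desc k hk, ?_⟩
  unfold aug
  have h1 := hex.g_desc k hk
  rw [Category.assoc, Iso.hom_inv_id_assoc]
  exact h1

theorem ext_zero {R : Type} [CommRing R] (X Y : ModuleCat.{0} R)
    (h : Subsingleton (((Ext R (ModuleCat R) 0).obj (op X)).obj Y)) (φ : X ⟶ Y) : φ = 0 := by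
  let P := projectiveResolution X
  have h0 : Limits.IsZero (((Ext R (ModuleCat R) 0).obj (op X)).obj Y) :=
    ModuleCat.isZero_of_subsingleton _
  have h1 := h0.of_iso (P.isoExt (R := R) 0 Y).symm
  rw [← HomologicalComplex.exactAt_iff_isZero_homology,
    HomologicalComplex.exactAt_iff' _ 0 0 1 (by simp) (by simp),
    ShortComplex.moduleCat_exact_iff] at h1
  obtain ⟨b, hb⟩ := h1 (aug P ≫ φ) (by
    change P.complex.d 1 0 ≫ aug P ≫ φ = 0
    rw [← Category.assoc, d_aug, Limits.zero_comp])
  let b' : P.complex.X 0 ⟶ Y := b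
  have hb' : P.complex.d 0 0 ≫ b' = aug P ≫ φ := hb
  rw [P.complex.shape 0 0 (by simp), Limits.zero_comp] at hb'
  rw [← cancel_epi (aug P), ← hb', Limits.comp_zero]

theorem ext_one {R : Type} [CommRing R] (X Y : ModuleCat.{0} R)
    (h : Subsingleton (((Ext R (ModuleCat R) 1).obj (op X)).obj Y)) (P : ProjectiveResolution X)
    (c : P.complex.X 1 ⟶ Y) (hc : P.complex.d 2 1 ≫ c = 0) :
    ∃ b : P.complex.X 0 ⟶ Y, P.complex.d 1 0 ≫ b = c := by
  have h0 : Limits.IsZero (((Ext R (ModuleCat R) 1).obj (op X)).obj Y) :=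
    ModuleCat.isZero_of_subsingleton _
  have h1 := h0.of_iso (P.isoExt (R := R) 1 Y).symm
  rw [← HomologicalComplex.exactAt_iff_isZero_homology,
    HomologicalComplex.exactAt_iff' _ 0 1 2 (by simp) (by simp),
    ShortComplex.moduleCat_exact_iff] at h1
  obtain ⟨b, hb⟩ := h1 c hc
  exact ⟨b, hb⟩


theorem lift_of_ext {R M : Type} [CommRing R] [AddCommGroup M] [Module R M]
    (h : Subsingleton (ExtGroup R 1 M M)) (t : R) (ht : ∀ z : M, t • z = 0 → z = 0)
    (g : M →ₗ[R] M ⧸ (Ideal.span {t} • ⊤ : Submodule R M)) :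
    ∃ φ : M →ₗ[R] M, (Submodule.mkQ _) ∘ₗ φ = g := by
  let X := ModuleCat.of R M
  let Q := ModuleCat.of R (M ⧸ (Ideal.span {t} • ⊤ : Submodule R M))
  let π : X ⟶ Q := ModuleCat.ofHom (Submodule.mkQ _)
  let γ : X ⟶ Q := ModuleCat.ofHom g
  have hepi : Epi π := by
    rw [ModuleCat.epi_iff_surjective]
    exact Submodule.mkQ_surjective _
  let P := projectiveResolution X
  let h0 : P.complex.X 0 ⟶ X := Projective.factorThru (aug P ≫ γ) π
  have hh0 : h0 ≫ π = aug P ≫ γ := Projective.factorThru_comp _ _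
  obtain ⟨c, hc⟩ := exists_div t ht (P.complex.d 1 0 ≫ h0).hom (by
    intro p
    have h1 : (P.complex.d 1 0 ≫ h0) ≫ π = 0 := by
      rw [Category.assoc, hh0, ← Category.assoc, d_aug, Limits.zero_comp]
    have h2 : π.hom ((P.complex.d 1 0 ≫ h0).hom p) = 0 := by
      have := congrArg (fun k => k.hom p) h1
      simpa using this
    have h3 := (Submodule.Quotient.mk_eq_zero _).1 h2
    rw [mem_span_smul] at h3
    obtain ⟨w, -, hw⟩ := h3
    exact ⟨w, hw⟩)
  let c' : P.complex.X 1 ⟶ X := ModuleCat.ofHom c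
  have hc' : P.complex.d 1 0 ≫ h0 = t • c' := by
    ext p
    exact LinearMap.congr_fun hc p
  obtain ⟨b, hb⟩ := ext_one X X h P c' (by
    ext p
    apply ht
    have h1 : P.complex.d 2 1 ≫ (t • c') = 0 := by
      rw [← hc', ← Category.assoc, P.complex.d_comp_d, Limits.zero_comp]
    have := congrArg (fun k => k.hom p) h1
    simpa using this)
  obtain ⟨φ, hφ⟩ := aug_desc P (h0 - t • b) (by
    rw [Preadditive.comp_sub, Linear.comp_smul, hb, hc', sub_self])
  have ht0 : t • π = 0 := by
    ext z
    change t • (Submodule.Quotient.mk z : M ⧸ (Ideal.span {t} • ⊤ : Submodule R M)) = 0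
    rw [← Submodule.Quotient.mk_smul, Submodule.Quotient.mk_eq_zero, mem_span_smul]
    exact ⟨z, trivial, rfl⟩
  have hfin : φ ≫ π = γ := by
    rw [← cancel_epi (aug P), ← Category.assoc, hφ, Preadditive.sub_comp, hh0, Linear.smul_comp,
      ← Linear.comp_smul, ht0, Limits.comp_zero, sub_zero]
  refine ⟨φ.hom, ?_⟩
  exact congrArg ModuleCat.Hom.hom hfin

theorem depth_one {R M : Type} [CommRing R] [IsLocalRing R] [AddCommGroup M] [Module R M]
    (h : moduleDepth R M = 1) (z : M) (hz : ∀ r ∈ maximalIdeal R, r • z = 0) : z = 0 := by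
  have hsub : Subsingleton (ExtGroup R 0 (ResidueField R) M) := by
    rw [← not_nontrivial_iff_subsingleton]
    intro hn
    have : moduleDepth R M ≤ 0 := sInf_le ⟨0, by simp, hn⟩
    rw [h] at this
    simp at this
  let φ : ResidueField R →ₗ[R] M :=
    Submodule.liftQ (maximalIdeal R) (LinearMap.toSpanSingleton R M z) (by
      intro r hr
      simpa using hz r hr)
  have h1 := ext_zero (ModuleCat.of R (ResidueField R)) (ModuleCat.of R M) hsub (ModuleCat.ofHom φ)
  have h2 : φ (Submodule.Quotient.mk 1) = 0 := by
    exact congrArg (fun k => k.hom (Submodule.Quotient.mk 1)) h1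
  have h3 : LinearMap.toSpanSingleton R M z 1 = 0 := h2
  simpa using h3

end RigidSI

namespace RigidSI

/-- The main result, for a named product `F` and without free summands. -/
theorem main_aux
    (S : Type) [CommRing S] [IsLocalRing S] (hS : IsRegularLocalTwoDim S)
    (hcomp : IsAdicComplete (IsLocalRing.maximalIdeal S) S)
    (n : ℕ) (f : Fin n → S) (hprime : ∀ i, Prime (f i)) (F : S) (hF : F = ∏ i, f i)
    [IsLocalRing (S ⧸ Ideal.span {F})]
    (M : Type) [AddCommGroup M] [Module (S ⧸ Ideal.span {F}) M]
    (hMmcm : IsMCM1 (S ⧸ Ideal.span {F}) M)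
    (hMind : IsIndecomposable (S ⧸ Ideal.span {F}) M)
    (hMrigid : Subsingleton (ExtGroup (S ⧸ Ideal.span {F}) 1 M M)) :
    ∃ I : Finset (Fin n), Nonempty (M ≃ₗ[S ⧸ Ideal.span {F}]
      ((S ⧸ Ideal.span {F}) ⧸
        Ideal.span {Ideal.Quotient.mk (Ideal.span {F}) (∏ i ∈ I, f i)})) := by
  classical
  obtain ⟨hnoeth, hdim, x, y, hm⟩ := hS
  obtain ⟨hfinR, hdepth⟩ := hMmcm
  have hdom : IsDomain S := RigidSI.isDomain_of_regular hdim x y hm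
  let mk : S →+* S ⧸ Ideal.span {F} := Ideal.Quotient.mk _
  have hmk : Function.Surjective mk := Ideal.Quotient.mk_surjective
  let _ : Module S M := Module.compHom M mk
  have hsm : ∀ (s : S) (z : M), s • z = mk s • z := fun _ _ => rfl
  have : IsScalarTower S (S ⧸ Ideal.span {F}) M := ⟨fun s r z => by
    obtain ⟨r, rfl⟩ := hmk r
    rw [hsm, smul_smul]
    rfl⟩
  have : Module.Finite S M := Module.Finite.trans (S ⧸ Ideal.span {F}) M
  -- an `S`-linear endomorphism is `R`-linear
  have toR : ∀ e : M →ₗ[S] M, ∃ e' : M →ₗ[S ⧸ Ideal.span {F}] M, ∀ z, e' z = e z := fun e =>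
    ⟨{ toFun := e, map_add' := map_add e, map_smul' := fun r z => by
        obtain ⟨r, rfl⟩ := hmk r
        exact map_smul e r z }, fun _ => rfl⟩
  obtain ⟨g, ⟨ψ⟩⟩ := RigidSI.core (M := M) hdim x y hm
    (by
      intro z hz
      apply RigidSI.depth_one hdepth z
      intro r hr
      obtain ⟨s, rfl⟩ := hmk r
      rw [← hsm]
      apply hz
      rw [IsLocalRing.mem_maximalIdeal] at hr ⊢
      exact fun hu => hr (hu.map mk))
    (by
      intro e he
      obtain ⟨e', he'⟩ := toR e
      rcases hMind.2 e' (by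
        ext z
        simp only [LinearMap.comp_apply, he']
        exact LinearMap.congr_fun he z) with h | h
      · left
        ext z
        rw [← he', h]; rfl
      · right
        ext z
        rw [← he', h]; rfl)
    (by
      intro t ht γ hadd hsmul
      obtain ⟨φ, hφ⟩ := RigidSI.lift_of_ext hMrigid (mk t) (fun z hz => ht z hz)
        { toFun := fun z => Submodule.Quotient.mk (γ z)
          map_add' := fun a b => by
            rw [← Submodule.Quotient.mk_add]
            exact (RigidSI.mk_eq_iff _ _ _).2 (hadd a b)
          map_smul' := fun r a => by
            obtain ⟨r, rfl⟩ := hmk r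
            rw [RingHom.id_apply, ← Submodule.Quotient.mk_smul]
            exact (RigidSI.mk_eq_iff _ _ _).2 (hsmul r a) }
      refine ⟨φ.restrictScalars S, fun z => ?_⟩
      exact (RigidSI.mk_eq_iff (mk t) (φ z) (γ z)).1 (LinearMap.congr_fun hφ z))
  -- `g` divides `F`
  have hgF : g ∣ F := by
    have h1 : F • ψ.symm (Submodule.Quotient.mk 1) = 0 := by
      rw [hsm, show mk F = 0 from Ideal.Quotient.eq_zero_iff_mem.2 (Ideal.mem_span_singleton_self F),
        zero_smul]
    rw [← map_smul, LinearEquiv.map_eq_zero_iff, ← Submodule.Quotient.mk_smul,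
      Submodule.Quotient.mk_eq_zero] at h1
    simpa [Ideal.mem_span_singleton] using h1
  obtain ⟨q, hq⟩ := hgF
  obtain ⟨I, u, b, c, -, -, hbc, hg, -⟩ := mul_eq_mul_prime_prod (x := g) (y := q) (a := 1)
    (s := Finset.univ) (p := f) (fun i _ => hprime i) (by rw [one_mul, ← hq, hF])
  have hb : IsUnit b := IsUnit.of_mul_eq_one c hbc.symm
  set G : S := ∏ i ∈ I, f i with hG
  have hgG : ∀ s, g ∣ s ↔ G ∣ s := fun s => by rw [hg, hb.mul_left_dvd]
  let z : M := ψ.symm (Submodule.Quotient.mk 1)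
  have hz : ∀ s : S, mk s • z = ψ.symm (Submodule.Quotient.mk s) := by
    intro s
    rw [← hsm, ← map_smul, ← Submodule.Quotient.mk_smul, smul_eq_mul, mul_one]
  have hsur : Function.Surjective (LinearMap.toSpanSingleton (S ⧸ Ideal.span {F}) M z) := by
    intro w
    obtain ⟨s, hs⟩ := Submodule.Quotient.mk_surjective _ (ψ w)
    refine ⟨mk s, ?_⟩
    rw [LinearMap.toSpanSingleton_apply, hz, hs, LinearEquiv.symm_apply_apply]
  have hker : LinearMap.ker (LinearMap.toSpanSingleton (S ⧸ Ideal.span {F}) M z) =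
      Ideal.span {Ideal.Quotient.mk (Ideal.span {F}) G} := by
    ext r
    obtain ⟨s, rfl⟩ := hmk r
    rw [LinearMap.mem_ker, LinearMap.toSpanSingleton_apply, hz, LinearEquiv.map_eq_zero_iff,
      Submodule.Quotient.mk_eq_zero, Ideal.mem_span_singleton, hgG, Ideal.mem_span_singleton]
    constructor
    · exact fun h => map_dvd mk h
    · rintro ⟨r, hr⟩
      obtain ⟨r, rfl⟩ := hmk r
      have h1 : mk s = mk (G * r) := by rw [map_mul]; exact hr
      rw [Ideal.Quotient.eq, Ideal.mem_span_singleton] at h1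
      have h2 : G ∣ F := (hgG F).1 ⟨q, hq⟩
      exact (dvd_sub_left (Dvd.intro _ rfl)).1 (h2.trans h1)
  exact ⟨I, ⟨(LinearMap.quotKerEquivOfSurjective _ hsur).symm.trans
    (Submodule.quotEquivOfEq _ _ hker)⟩⟩

end RigidSI

/-- Let `(S, m)` be a complete regular local ring of dimension `2` with algebraically
closed residue field of characteristic `≠ 2`, and `R = S/(f_1⋯f_n)` a reduced hypersurface
with the `f_i` pairwise non-associate primes.  Then any indecomposable rigid maximal
Cohen-Macaulay `R`-module is isomorphic, up to free summands, to `S_I = S/(∏_{i∈I} f_i)`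
for some `I ⊆ {1,…,n}`. -/
theorem indecomposable_rigid_iso_SI
    (S : Type) [CommRing S] [IsLocalRing S] (hS : IsRegularLocalTwoDim S)
    (hcomp : IsAdicComplete (IsLocalRing.maximalIdeal S) S)
    [IsAlgClosed (ResidueField S)] (hchar : (2 : ResidueField S) ≠ 0)
    (n : ℕ) (f : Fin n → S) (hprime : ∀ i, Prime (f i))
    (hassoc : ∀ i j, i ≠ j → ¬Associated (f i) (f j))
    [IsLocalRing (S ⧸ Ideal.span {∏ i, f i})]
    (M : Type) [AddCommGroup M] [Module (S ⧸ Ideal.span {∏ i, f i}) M]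
    (hMmcm : IsMCM1 (S ⧸ Ideal.span {∏ i, f i}) M)
    (hMind : IsIndecomposable (S ⧸ Ideal.span {∏ i, f i}) M)
    (hMrigid : Subsingleton (ExtGroup (S ⧸ Ideal.span {∏ i, f i}) 1 M M)) :
    ∃ (I : Finset (Fin n)) (k l : ℕ),
      Nonempty ((M × (Fin k → (S ⧸ Ideal.span {∏ i, f i}))) ≃ₗ[S ⧸ Ideal.span {∏ i, f i}]
        (((S ⧸ Ideal.span {∏ i, f i}) ⧸
          Ideal.span {Ideal.Quotient.mk (Ideal.span {∏ i, f i}) (∏ i ∈ I, f i)}) ×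
            (Fin l → (S ⧸ Ideal.span {∏ i, f i})))) := by
  obtain ⟨I, ⟨e⟩⟩ := RigidSI.main_aux S hS hcomp n f hprime _ rfl M hMmcm hMind hMrigid
  exact ⟨I, 0, 0, ⟨LinearEquiv.prodCongr e (LinearEquiv.refl _ _)⟩⟩
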